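/- arXiv:0901.1481 — 9 statements merged into one kernel-verified Lean document; each statement's English description precedes it below -/
import Mathlib

section
/- Let c > 0 and Λ ≥ 4 be real numbers, and let x, y be nonnegative real numbers satisfying y ≥ c·(x+y)² and x ≥ (Λ−1)·y. Then x − y ≤ (Λ−2)/(c·Λ²). -/
theorem stmt_1 (c Λ x y : ℝ) (hc : 0 < c) (hΛ : Λ ≥ 4) (hx : 0 ≤ x) (hy : 0 ≤ y)
    (h1 : y ≥ c * (x + y)^2) (h2 : x ≥ (Λ - 1) * y) :
    x - y ≤ (Λ - 2) / (c * Λ^2) := by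
  have hL : 0 < Λ := by linarith
  have hu : c * (x + y) * Λ ≤ 1 := by
    rcases (add_nonneg hx hy).eq_or_lt with h | h
    · rw [← h]; norm_num
    · have h3 : Λ * (c * (x + y)^2) ≤ Λ * y := mul_le_mul_of_nonneg_left h1 hL.le
      have h4 : (c * (x + y) * Λ) * (x + y) ≤ 1 * (x + y) := by linarith
      exact le_of_mul_le_mul_right h4 h
  rw [le_div_iff₀ (by positivity)]
  have h5 : (c * Λ^2) * (c * (x + y)^2) ≤ (c * Λ^2) * y :=
    mul_le_mul_of_nonneg_left h1 (by positivity)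
  have h6 : 0 ≤ (1 - c * (x + y) * Λ) * (Λ - 2 - 2 * (c * (x + y) * Λ)) :=
    mul_nonneg (by linarith) (by linarith)
  linarith
end

section
/- Let v > 0 be a real number and let x, y be nonnegative real numbers satisfying y ≥ ((v+6)/(4v))·(x+y)². Then 1/12 − x/6 + y/6 ≥ 1/(2(v+6)). -/
theorem stmt_2 (v x y : ℝ) (hv : 0 < v) (hx : 0 ≤ x) (hy : 0 ≤ y)
    (h : y ≥ ((v + 6) / (4 * v)) * (x + y)^2) :
    1 / 12 - x / 6 + y / 6 ≥ 1 / (2 * (v + 6)) := by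
  have h1 : (v + 6) * (x + y)^2 ≤ y * (4 * v) := by
    have h2 : (v + 6) * (x + y)^2 / (4 * v) ≤ y := by
      rw [mul_div_right_comm]; exact h
    exact (div_le_iff₀ (by positivity)).1 h2
  have h3 : 0 ≤ v * (v - 2 * (v + 6) * (x - y)) := by
    have h4 := mul_le_mul_of_nonneg_left h1 (by linarith : (0:ℝ) ≤ v + 6)
    have h5 := sq_nonneg (v - (v + 6) * (x + y))
    linarith
  have h6 : 0 ≤ v - 2 * (v + 6) * (x - y) := nonneg_of_mul_nonneg_right h3 hv
  rw [ge_iff_le, div_le_iff₀ (by positivity)]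
  linarith
end

section
/- Let v > 0 and Λ ≥ 4 be real numbers, and let x, y be nonnegative real numbers satisfying y ≥ ((v+6)/(4v))·(x+y)² and x ≥ (Λ−1)·y. Then 1/12 − x/6 + y/6 ≥ (1/12)·(1 − 4/Λ)² + 4(Λ−2)/((v+6)·Λ²). -/
theorem stmt_3 (v Λ x y : ℝ) (hv : 0 < v) (hΛ : Λ ≥ 4) (hx : 0 ≤ x) (hy : 0 ≤ y)
    (h1 : y ≥ ((v + 6) / (4 * v)) * (x + y)^2) (h2 : x ≥ (Λ - 1) * y) :
    1 / 12 - x / 6 + y / 6 ≥ (1 / 12) * (1 - 4 / Λ)^2 + 4 * (Λ - 2) / ((v + 6) * Λ^2) := by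
  obtain ⟨d, hd⟩ : ∃ d, d = 4 * v / (v + 6) := ⟨_, rfl⟩
  obtain ⟨u, hu⟩ : ∃ u, u = 1 / Λ := ⟨_, rfl⟩
  obtain ⟨s, hs⟩ : ∃ s, s = x + y := ⟨_, rfl⟩
  have hL : 0 < Λ := by linarith
  have hd0 : 0 < d := by rw [hd]; positivity
  have hu0 : 0 < u := by rw [hu]; positivity
  have huL : Λ * u = 1 := by rw [hu]; field_simp
  have hu4 : u ≤ 1 / 4 := by nlinarith
  have hs0 : 0 ≤ s := by linarith
  have h3 : s ^ 2 ≤ d * y := by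
    have h := mul_le_mul_of_nonneg_left h1 hd0.le
    have e : d * (((v + 6) / (4 * v)) * (x + y)^2) = s ^ 2 := by
      rw [hd, hs]; field_simp
    linarith
  have h4 : Λ * y ≤ s := by rw [hs]; linarith
  have h5 : y ≤ s * u := by
    have := mul_le_mul_of_nonneg_right h4 hu0.le
    have e : Λ * y * u = y := by linear_combination y * huL
    linarith
  have h6 : s ≤ d * u := by
    by_contra h
    push Not at h
    have hsp : 0 < s := lt_trans (by positivity) h
    have := mul_le_mul_of_nonneg_left h5 hd0.le
    nlinarith
  have h7 : 0 ≤ (d * u - s) * (d - 2 * (d * u + s)) := by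
    apply mul_nonneg
    · linarith
    · nlinarith
  have h8 : 0 ≤ d * u - 2 * d * u ^ 2 - s + 2 * y := by
    by_contra h
    push Not at h
    have := mul_neg_of_pos_of_neg hd0 h
    nlinarith
  have e : (1 / 12) * (1 - 4 / Λ)^2 + 4 * (Λ - 2) / ((v + 6) * Λ^2)
      = 1 / 12 - (d * u - 2 * d * u ^ 2) / 6 := by
    rw [hd, hu]; field_simp; ring
  rw [e]
  linarith
end

section
/- Let v > 0 and Λ ≥ 6 be real numbers, and let x, y be nonnegative real numbers satisfying y ≥ ((v+6)/(4v))·(x+y)² and x ≥ (Λ−1)·y. Then 1/12 − x/6 + y/6 ≥ 1/108. -/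
theorem stmt_4 (v Λ x y : ℝ) (hv : 0 < v) (hΛ : Λ ≥ 6) (hx : 0 ≤ x) (hy : 0 ≤ y)
    (h1 : y ≥ ((v + 6) / (4 * v)) * (x + y)^2) (h2 : x ≥ (Λ - 1) * y) :
    1 / 12 - x / 6 + y / 6 ≥ 1 / 108 := by
  have hc : (1 : ℝ) / 4 ≤ (v + 6) / (4 * v) := by
    rw [div_le_div_iff₀ (by norm_num) (by positivity)]
    linarith
  have h3 : 1 / 4 * (x + y)^2 ≤ y :=
    le_trans (mul_le_mul_of_nonneg_right hc (sq_nonneg _)) h1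
  have h4 : 5 * y ≤ x := by nlinarith [mul_nonneg (sub_nonneg.2 hΛ) hy]
  have h5 : x + y ≤ 2 / 3 := by
    by_contra h
    push Not at h
    nlinarith [mul_pos (sub_pos.2 h) (by linarith : 0 < x + y)]
  nlinarith [mul_nonneg (sub_nonneg.2 h5) (by linarith : 0 ≤ 4 / 3 - (x + y))]
end

section
/- Let v > 0 and Λ ≥ 5 be real numbers, and let x, y be nonnegative real numbers satisfying y ≥ ((v+6)/(4v))·(x+y)² and x ≥ (Λ−1)·y. Then 1/12 − x/6 + y/6 ≥ 1/300. -/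
theorem stmt_5 (v Λ x y : ℝ) (hv : 0 < v) (hΛ : Λ ≥ 5) (hx : 0 ≤ x) (hy : 0 ≤ y)
    (h1 : y ≥ ((v + 6) / (4 * v)) * (x + y)^2) (h2 : x ≥ (Λ - 1) * y) :
    1 / 12 - x / 6 + y / 6 ≥ 1 / 300 := by
  have hc : (1 / 4 : ℝ) ≤ (v + 6) / (4 * v) := by
    rw [div_le_div_iff₀ (by norm_num) (by positivity)]
    linarith
  have h3 : 1 / 4 * (x + y)^2 ≤ y :=
    le_trans (mul_le_mul_of_nonneg_right hc (sq_nonneg _)) h1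
  have h4 : 4 * y ≤ x := by nlinarith
  have hs : x + y ≤ 4 / 5 := by
    by_contra h
    push Not at h
    nlinarith
  nlinarith [mul_nonneg (sub_nonneg.2 hs) (by linarith : (0:ℝ) ≤ 6 / 5 - (x + y))]
end

section
/- Let v be a real number with 0 < v ≤ 48, and let x, y be nonnegative real numbers satisfying y ≥ ((v+6)/(4v))·(x+y)². Then 1/12 − x/6 + y/6 ≥ 1/108. -/
theorem stmt_6 (v x y : ℝ) (hv : 0 < v) (hv48 : v ≤ 48) (hx : 0 ≤ x) (hy : 0 ≤ y)
    (h : y ≥ ((v + 6) / (4 * v)) * (x + y)^2) :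
    1 / 12 - x / 6 + y / 6 ≥ 1 / 108 := by
  have hc : (9 / 32 : ℝ) ≤ (v + 6) / (4 * v) := by
    rw [le_div_iff₀ (by positivity)]
    linarith
  have h2 := mul_le_mul_of_nonneg_right hc (sq_nonneg (x + y))
  have h3 := sq_nonneg (3 / 4 * (x + y) - 2 / 3)
  have h4 : 9 / 32 * (x + y)^2 ≤ y := le_trans h2 h
  linarith
end

section
/- Let n ≥ 2 be a natural number and let L : Fin n → ℝ satisfy L t > 0 for all t. Set S := ∑_t (L t)⁻¹ and, for each t, R t := (S − (L t)⁻¹)⁻¹. Then ∑_t (L t)²·(R t)/(L t + R t)² = (n − 1)/S. -/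
theorem stmt_8 (n : ℕ) (hn : 2 ≤ n) (L : Fin n → ℝ) (hL : ∀ t, 0 < L t)
    (S : ℝ) (hS : S = ∑ t, (L t)⁻¹)
    (R : Fin n → ℝ) (hR : ∀ t, R t = (S - (L t)⁻¹)⁻¹) :
    ∑ t, (L t)^2 * R t / (L t + R t)^2 = ((n : ℝ) - 1) / S := by
  have hpos : ∀ t, 0 < S - (L t)⁻¹ := by
    intro t
    have h1 := Finset.add_sum_erase Finset.univ (fun t => (L t)⁻¹) (Finset.mem_univ t)
    have h2 : 0 < ∑ x ∈ Finset.univ.erase t, (L x)⁻¹ := by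
      apply Finset.sum_pos
      · intro i _
        exact inv_pos.mpr (hL i)
      · rw [← Finset.card_pos, Finset.card_erase_of_mem (Finset.mem_univ t), Finset.card_univ,
          Fintype.card_fin]
        omega
    linarith
  have hS0 : 0 < S := by
    have h1 := hpos ⟨0, by omega⟩
    have h2 := inv_pos.mpr (hL ⟨0, by omega⟩)
    linarith
  have key : ∀ t, (L t)^2 * R t / (L t + R t)^2 = (S - (L t)⁻¹) / S^2 := by
    intro t
    have hb := hpos t
    have hl := hL t
    rw [hR t]
    obtain ⟨b, hbdef⟩ : ∃ b, b = S - (L t)⁻¹ := ⟨_, rfl⟩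
    have hSb : S = b + (L t)⁻¹ := by linarith
    rw [← hbdef] at hb ⊢
    rw [hSb]
    generalize L t = l at *
    have e : l + b⁻¹ = (b + l⁻¹) * (l * b⁻¹) := by
      field_simp
    have : 0 < b + l⁻¹ := by positivity
    rw [e]
    generalize b + l⁻¹ = s at *
    field_simp
  rw [Finset.sum_congr rfl (fun t _ => key t), ← Finset.sum_div, Finset.sum_sub_distrib, ← hS]
  simp only [Finset.sum_const, Finset.card_univ, Fintype.card_fin, nsmul_eq_mul]
  field_simp
end

section
/- Let n ≥ 2 be a natural number and let L : Fin n → ℝ satisfy L t > 0 for all t. Set S := ∑_t (L t)⁻¹ and, for each t, R t := (S − (L t)⁻¹)⁻¹. Then ∑_t (L t)·(R t)²/(L t + R t)² = 1/S. -/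
theorem stmt_9 (n : ℕ) (hn : 2 ≤ n) (L : Fin n → ℝ) (hL : ∀ t, 0 < L t)
    (S : ℝ) (hS : S = ∑ t, (L t)⁻¹)
    (R : Fin n → ℝ) (hR : ∀ t, R t = (S - (L t)⁻¹)⁻¹) :
    ∑ t, L t * (R t)^2 / (L t + R t)^2 = 1 / S := by
  haveI : Nontrivial (Fin n) := Fin.nontrivial_iff_two_le.mpr hn
  have hpos : ∀ t, 0 < S - (L t)⁻¹ := by
    intro t
    obtain ⟨u, hu⟩ := exists_ne t
    have h1 : S - (L t)⁻¹ = ∑ s ∈ Finset.univ.erase t, (L s)⁻¹ := by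
      rw [hS, ← Finset.add_sum_erase _ _ (Finset.mem_univ t)]
      ring
    rw [h1]
    exact Finset.sum_pos (fun s _ => inv_pos.mpr (hL s)) ⟨u, by simp [hu]⟩
  have hSpos : 0 < S := by
    have t : Fin n := ⟨0, by omega⟩
    have := hpos t
    have := inv_pos.mpr (hL t)
    linarith
  have key : ∀ t, L t * (R t)^2 / (L t + R t)^2 = (L t)⁻¹ * (1 / S ^ 2) := by
    intro t
    have hl := hL t
    have hd := hpos t
    have hRp : 0 < R t := by rw [hR]; exact inv_pos.mpr hd
    have hrel : L t + R t = R t * (L t * S) := by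
      have h2 : R t * (S - (L t)⁻¹) = 1 := by rw [hR]; exact inv_mul_cancel₀ hd.ne'
      have h3 : L t * (L t)⁻¹ = 1 := mul_inv_cancel₀ hl.ne'
      linear_combination (-(L t)) * h2 - R t * h3
    rw [hrel]
    field_simp
  rw [Finset.sum_congr rfl (fun t _ => key t), ← Finset.sum_mul, ← hS]
  field_simp
end

section
/- Let n ≥ 2 be a natural number and let L : Fin n → ℝ satisfy L t > 0 for all t. Set S := ∑_t (L t)⁻¹ and, for each t, R t := (S − (L t)⁻¹)⁻¹. Then ∑_t (L t)²/(L t + R t) ≥ n(n−1)/S. -/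
theorem stmt_11 (n : ℕ) (hn : 2 ≤ n) (L : Fin n → ℝ) (hL : ∀ t, 0 < L t)
    (S : ℝ) (hS : S = ∑ t, (L t)⁻¹)
    (R : Fin n → ℝ) (hR : ∀ t, R t = (S - (L t)⁻¹)⁻¹) :
    ∑ t, (L t)^2 / (L t + R t) ≥ (n : ℝ) * ((n : ℝ) - 1) / S := by
  have hlt : ∀ t, (L t)⁻¹ < S := by
    intro t
    have : Nontrivial (Fin n) := Fin.nontrivial_iff_two_le.mpr hn
    obtain ⟨s, hs⟩ := exists_ne t
    rw [hS]
    exact Finset.single_lt_sum hs (Finset.mem_univ t) (Finset.mem_univ s)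
      (inv_pos.mpr (hL s)) (fun k _ _ => (inv_pos.mpr (hL k)).le)
  have hSpos : 0 < S := (inv_pos.mpr (hL ⟨0, by omega⟩)).trans (hlt ⟨0, by omega⟩)
  have hterm : ∀ t, (L t)^2 / (L t + R t) = L t - 1 / S := by
    intro t
    have h1 := hL t
    have h2 : 0 < S - (L t)⁻¹ := sub_pos.mpr (hlt t)
    have h3 : L t * (S - (L t)⁻¹) = L t * S - 1 := by field_simp
    have h4 : L t + R t = L t * S / (S - (L t)⁻¹) := by
      rw [hR, eq_div_iff h2.ne', add_mul, inv_mul_cancel₀ h2.ne', h3]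
      ring
    rw [h4]
    field_simp
  have hbound : ∀ t, 2 * ((n : ℝ) / S) - ((n : ℝ) / S)^2 * (L t)⁻¹ - 1 / S
      ≤ (L t)^2 / (L t + R t) := by
    intro t
    rw [hterm]
    have h1 := hL t
    have h : 0 ≤ (L t - (n : ℝ) / S)^2 * (L t)⁻¹ := by positivity
    have h5 : (L t - (n : ℝ) / S)^2 * (L t)⁻¹
        = L t - 2 * ((n : ℝ) / S) + ((n : ℝ) / S)^2 * (L t)⁻¹ := by
      field_simp
      ring
    linarith
  have hsum := Finset.sum_le_sum (fun t (_ : t ∈ Finset.univ) => hbound t)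
  rw [Finset.sum_sub_distrib, Finset.sum_sub_distrib, ← Finset.mul_sum, ← Finset.mul_sum, ← hS] at hsum
  simp only [Finset.sum_const, Finset.card_univ, Fintype.card_fin, nsmul_eq_mul] at hsum
  have h6 : 2 * ((n : ℝ) * ((n : ℝ) / S)) - ((n : ℝ) / S)^2 * S - n * (1 / S)
      = (n : ℝ) * ((n : ℝ) - 1) / S := by
    field_simp
    ring
  linarith
end
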